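/- arXiv:1703.00312 — 2 statements merged into one kernel-verified Lean document; each statement's English description precedes it below -/
import Mathlib

section
/- Let V be a nonempty finite voxel set and L a finite label set, and let X⁽¹⁾, …, X⁽ⁿ⁾ and Y⁽¹⁾, …, Y⁽ⁿ⁾ be two families of labelings X⁽ˢ⁾, Y⁽ˢ⁾ : V → L with empirical marginals f̂_X(i, l) = (1/n) Σ_{s=1}^n 1{X⁽ˢ⁾(i) = l} and f̂_Y(i, l) = (1/n) Σ_{s=1}^n 1{Y⁽ˢ⁾(i) = l}. If there exists ε ≥ 0 such that the voxel-wise Hamming loss satisfies ℓ(X⁽ˢ⁾, Y⁽ˢ⁾) ≤ ε for every s = 1, …, n, then the voxel-averaged total variation distance between the empirical marginal families is at most ε: 0 ≤ (1/|V|) Σ_{i∈V} (1/2) Σ_{l∈L} | f̂_X(i, l) − f̂_Y(i, l) | ≤ ε. -/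
/-- **Proposition 2**: if the voxel-wise Hamming loss between every pair of corresponding
labelings is at most `ε`, then the voxel-averaged total variation distance between the two
empirical marginal families lies in `[0, ε]`. -/
theorem averaged_tv_le_of_hamming_le
    {V L : Type*} [Fintype V] [Nonempty V] [Fintype L] [DecidableEq V] [DecidableEq L]
    {n : ℕ} (hn : 0 < n) (X Y : Fin n → V → L) (ε : ℝ) (hε : 0 ≤ ε)
    (hloss : ∀ s : Fin n,
      (1 / (Fintype.card V : ℝ)) * ∑ i : V, (if X s i ≠ Y s i then (1 : ℝ) else 0) ≤ ε) :
    0 ≤ (1 / (Fintype.card V : ℝ)) * ∑ i : V, (1 / 2) * ∑ l : L,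
        |(∑ s : Fin n, if X s i = l then (1 : ℝ) else 0) / n -
          (∑ s : Fin n, if Y s i = l then (1 : ℝ) else 0) / n| ∧
      (1 / (Fintype.card V : ℝ)) * ∑ i : V, (1 / 2) * ∑ l : L,
        |(∑ s : Fin n, if X s i = l then (1 : ℝ) else 0) / n -
          (∑ s : Fin n, if Y s i = l then (1 : ℝ) else 0) / n| ≤ ε := by
  refine ⟨by positivity, ?_⟩
  have hn' : (0 : ℝ) < n := by exact_mod_cast hn
  have key : ∀ i : V, (1 / 2 : ℝ) * ∑ l : L,
        |(∑ s : Fin n, if X s i = l then (1 : ℝ) else 0) / n -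
          (∑ s : Fin n, if Y s i = l then (1 : ℝ) else 0) / n| ≤
        (∑ s : Fin n, if X s i ≠ Y s i then (1 : ℝ) else 0) / n := by
    intro i
    have h1 : ∀ l : L, |(∑ s : Fin n, if X s i = l then (1 : ℝ) else 0) / n -
          (∑ s : Fin n, if Y s i = l then (1 : ℝ) else 0) / n| ≤
        (∑ s : Fin n, |(if X s i = l then (1 : ℝ) else 0) -
          (if Y s i = l then (1 : ℝ) else 0)|) / n := by
      intro l
      rw [← sub_div, abs_div, abs_of_pos hn', ← Finset.sum_sub_distrib]
      gcongr
      exact Finset.abs_sum_le_sum_abs _ _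
    have h2 : ∀ s : Fin n, ∑ l : L, |(if X s i = l then (1 : ℝ) else 0) -
          (if Y s i = l then (1 : ℝ) else 0)| ≤ 2 * (if X s i ≠ Y s i then (1 : ℝ) else 0) := by
      intro s
      by_cases h : X s i = Y s i
      · simp [h]
      · calc _ ≤ ∑ l : L, ((if X s i = l then (1 : ℝ) else 0) +
              (if Y s i = l then (1 : ℝ) else 0)) := by
              refine Finset.sum_le_sum fun l _ => ?_
              split_ifs <;> norm_num
          _ = 2 * (if X s i ≠ Y s i then (1 : ℝ) else 0) := by
              rw [Finset.sum_add_distrib]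
              simp [h]
              norm_num
    calc _ ≤ (1 / 2 : ℝ) * ∑ l : L, (∑ s : Fin n, |(if X s i = l then (1 : ℝ) else 0) -
          (if Y s i = l then (1 : ℝ) else 0)|) / n := by
            gcongr with l _
            exact h1 l
      _ = (1 / 2 : ℝ) * ((∑ s : Fin n, ∑ l : L, |(if X s i = l then (1 : ℝ) else 0) -
          (if Y s i = l then (1 : ℝ) else 0)|) / n) := by
            rw [← Finset.sum_div, Finset.sum_comm]
      _ ≤ (1 / 2 : ℝ) * ((∑ s : Fin n, 2 * (if X s i ≠ Y s i then (1 : ℝ) else 0)) / n) := by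
            have := Finset.sum_le_sum fun s (_ : s ∈ Finset.univ) => h2 s
            exact mul_le_mul_of_nonneg_left (div_le_div_of_nonneg_right this hn'.le) (by norm_num)
      _ = _ := by
            rw [← Finset.mul_sum]
            ring
  calc _ ≤ (1 / (Fintype.card V : ℝ)) * ∑ i : V,
        (∑ s : Fin n, if X s i ≠ Y s i then (1 : ℝ) else 0) / n :=
          mul_le_mul_of_nonneg_left (Finset.sum_le_sum fun i _ => key i) (by positivity)
    _ = (∑ s : Fin n, (1 / (Fintype.card V : ℝ)) *
        ∑ i : V, (if X s i ≠ Y s i then (1 : ℝ) else 0)) / n := by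
          rw [← Finset.sum_div, Finset.sum_comm, ← Finset.mul_sum, mul_div_assoc]
    _ ≤ (∑ _s : Fin n, ε) / n :=
          div_le_div_of_nonneg_right (Finset.sum_le_sum fun s _ => hloss s) hn'.le
    _ = ε := by
          simp
          field_simp
end

section
/- Let L be a finite set with |L| = m ≥ 2 and let p, q be probability distributions on L. Let ε = (1/2) Σ_{l∈L} |p(l) − q(l)| be their total variation distance. Then the difference of their Shannon entropies (in bits) satisfies |H(p) − H(q)| ≤ ε · log₂(m − 1) + h(ε), where H(p) = −Σ_{l∈L} p(l) log₂ p(l) (with the convention 0 log₂ 0 = 0) and h(ε) = −ε log₂ ε − (1 − ε) log₂(1 − ε) is the binary entropy function (with h(0) = h(1) = 0). -/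
open Real

theorem aux_log_mono {x y : ℝ} (hx : 0 ≤ x) (hxy : x ≤ y) : x * log x ≤ x * log y := by
  rcases hx.eq_or_lt with h | h
  · simp [← h]
  · exact mul_le_mul_of_nonneg_left (log_le_log h hxy) hx

theorem aux_subadd {x y : ℝ} (hx : 0 ≤ x) (hy : 0 ≤ y) :
    negMulLog (x + y) ≤ negMulLog x + negMulLog y := by
  have h1 := aux_log_mono hx (show x ≤ x + y by linarith)
  have h2 := aux_log_mono hy (show y ≤ x + y by linarith)
  simp only [negMulLog]
  nlinarith

theorem aux_scale {r t : ℝ} (h : t = 0 → r = 0) :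
    t * negMulLog (r / t) = negMulLog r + r * log t := by
  by_cases ht : t = 0
  · simp [ht, h ht]
  by_cases hr : r = 0
  · simp [hr]
  simp only [negMulLog]
  rw [log_div hr ht]
  field_simp
  ring

theorem aux_concave {r b e : ℝ} (hr : 0 ≤ r) (hb : 0 ≤ b) (he0 : 0 ≤ e) (he1 : e ≤ 1)
    (h1 : 1 - e = 0 → r = 0) (h2 : e = 0 → b = 0) :
    negMulLog r + r * log (1 - e) + (negMulLog b + b * log e) ≤ negMulLog (r + b) := by
  have hh : 0 ≤ 1 - e := by linarith
  have := concaveOn_negMulLog.2 (x := r / (1 - e)) (div_nonneg hr hh) (y := b / e)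
    (div_nonneg hb he0) hh he0 (by ring)
  simp only [smul_eq_mul] at this
  rw [aux_scale h1, aux_scale h2, mul_div_cancel_of_imp' h1, mul_div_cancel_of_imp' h2] at this
  exact this

theorem aux_tangent {a c : ℝ} (ha : 0 ≤ a) (hc : 0 < c) :
    negMulLog a ≤ -a * log c + (c - a) := by
  have h := self_sub_one_le_mul_log (div_nonneg ha hc.le)
  rcases ha.eq_or_lt with h0 | h0
  · simp [← h0, hc.le]
  rw [log_div h0.ne' hc.ne'] at h
  have h3 := mul_le_mul_of_nonneg_left h hc.le
  have e1 : c * (a / c - 1) = a - c := by field_simp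
  have e2 : c * (a / c * (log a - log c)) = a * (log a - log c) := by field_simp
  rw [e1, e2] at h3
  simp only [negMulLog]
  linarith

theorem aux_one_sided {L : Type*} [Fintype L] (hm : 2 ≤ Fintype.card L)
    (p q : L → ℝ)
    (hp0 : ∀ l, 0 ≤ p l) (hp1 : ∑ l : L, p l = 1)
    (hq0 : ∀ l, 0 ≤ q l) (hq1 : ∑ l : L, q l = 1)
    (ε : ℝ) (hε : ε = (1 / 2) * ∑ l : L, |p l - q l|) :
    ∑ l, negMulLog (p l) - ∑ l, negMulLog (q l) ≤
      ε * log ((Fintype.card L : ℝ) - 1) + (negMulLog ε + negMulLog (1 - ε)) := by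
  classical
  obtain ⟨r, hr⟩ : ∃ r : L → ℝ, ∀ l, r l = (p l + q l - |p l - q l|) / 2 := ⟨_, fun _ => rfl⟩
  obtain ⟨a, ha⟩ : ∃ a : L → ℝ, ∀ l, a l = p l - r l := ⟨_, fun _ => rfl⟩
  obtain ⟨b, hb⟩ : ∃ b : L → ℝ, ∀ l, b l = q l - r l := ⟨_, fun _ => rfl⟩
  have hr0 : ∀ l, 0 ≤ r l := fun l => by
    have := hp0 l; have := hq0 l; rw [hr]
    rcases abs_cases (p l - q l) with h | h <;> linarith
  have ha0 : ∀ l, 0 ≤ a l := fun l => by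
    rw [ha, hr]; rcases abs_cases (p l - q l) with h | h <;> linarith
  have hb0 : ∀ l, 0 ≤ b l := fun l => by
    rw [hb, hr]; rcases abs_cases (p l - q l) with h | h <;> linarith
  have hrs : ∑ l, r l = 1 - ε := by
    simp only [hr]
    rw [← Finset.sum_div, Finset.sum_sub_distrib, Finset.sum_add_distrib, hp1, hq1, hε]; ring
  have has : ∑ l, a l = ε := by
    simp only [ha]; rw [Finset.sum_sub_distrib, hp1, hrs]; ring
  have hbs : ∑ l, b l = ε := by
    simp only [hb]; rw [Finset.sum_sub_distrib, hq1, hrs]; ring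
  have he0 : 0 ≤ ε := has ▸ Finset.sum_nonneg fun l _ => ha0 l
  have he1 : ε ≤ 1 := by
    have : 0 ≤ ∑ l, r l := Finset.sum_nonneg fun l _ => hr0 l
    linarith
  have hbe : ∀ l, b l ≤ ε := fun l =>
    hbs ▸ Finset.single_le_sum (fun i _ => hb0 i) (Finset.mem_univ l)
  have hre : ∀ l, r l ≤ 1 - ε := fun l =>
    hrs ▸ Finset.single_le_sum (fun i _ => hr0 i) (Finset.mem_univ l)
  have hne : Nonempty L := Fintype.card_pos_iff.mp (by omega)
  have hP : ∑ l, negMulLog (p l) ≤ ∑ l, negMulLog (r l) + ∑ l, negMulLog (a l) := by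
    rw [← Finset.sum_add_distrib]
    refine Finset.sum_le_sum fun l _ => ?_
    have := aux_subadd (hr0 l) (ha0 l)
    rwa [ha, add_sub_cancel, ← ha] at this
  have hQ : ∑ l, negMulLog (r l) + (1 - ε) * log (1 - ε)
      + (∑ l, negMulLog (b l) + ε * log ε) ≤ ∑ l, negMulLog (q l) := by
    have h : ∑ l, (negMulLog (r l) + r l * log (1 - ε) + (negMulLog (b l) + b l * log ε))
        ≤ ∑ l, negMulLog (q l) := by
      refine Finset.sum_le_sum fun l _ => ?_
      have := aux_concave (hr0 l) (hb0 l) he0 he1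
        (fun h => le_antisymm (h ▸ hre l) (hr0 l)) (fun h => le_antisymm (h ▸ hbe l) (hb0 l))
      have e : r l + b l = q l := by rw [hb]; ring
      rwa [e] at this
    rw [Finset.sum_add_distrib, Finset.sum_add_distrib, Finset.sum_add_distrib,
      ← Finset.sum_mul, ← Finset.sum_mul, hrs, hbs] at h
    exact h
  have hB : -(ε * log ε) ≤ ∑ l, negMulLog (b l) := by
    have h : ∑ l, -(b l * log ε) ≤ ∑ l, negMulLog (b l) := by
      refine Finset.sum_le_sum fun l _ => ?_
      have := aux_log_mono (hb0 l) (hbe l)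
      simp only [negMulLog]; linarith
    rwa [Finset.sum_neg_distrib, ← Finset.sum_mul, hbs] at h
  have hA : ∑ l, negMulLog (a l) ≤ ε * log ((Fintype.card L : ℝ) - 1) - ε * log ε := by
    rcases he0.eq_or_lt with h0 | h0
    · have : ∀ l, a l = 0 := fun l => by
        have := (Finset.sum_eq_zero_iff_of_nonneg (fun i _ => ha0 i)).1 (has.trans h0.symm)
        exact this l (Finset.mem_univ l)
      simp [this, ← h0]
    obtain ⟨l0, hl0⟩ : ∃ l, a l = 0 := by
      by_contra! hcon
      have : ∑ l, q l < ∑ l, p l := by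
        refine Finset.sum_lt_sum_of_nonempty Finset.univ_nonempty fun l _ => ?_
        by_contra! hle
        apply hcon l
        rw [ha, hr, abs_of_nonpos (by linarith)]; ring
      linarith
    have hn : (0 : ℝ) < (Fintype.card L : ℝ) - 1 := by
      have : (2 : ℝ) ≤ Fintype.card L := by exact_mod_cast hm
      linarith
    generalize hN : (Fintype.card L : ℝ) - 1 = n at hn
    have hcard : ((Finset.univ.erase l0).card : ℝ) = n := by
      rw [Finset.card_erase_of_mem (Finset.mem_univ _), Finset.card_univ,
        Nat.cast_sub (by omega), ← hN]; simp
    have hs : ∑ l ∈ Finset.univ.erase l0, a l = ε := by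
      rw [← has, Finset.sum_erase _ hl0]
    rw [← Finset.sum_erase (a := l0) _ (by simp [hl0])]
    have hc : 0 < ε / n := div_pos h0 hn
    calc ∑ l ∈ Finset.univ.erase l0, negMulLog (a l)
        ≤ ∑ l ∈ Finset.univ.erase l0, (-a l * log (ε / n) + (ε / n - a l)) :=
          Finset.sum_le_sum fun l _ => aux_tangent (ha0 l) hc
      _ = -ε * log (ε / n) + (n * (ε / n) - ε) := by
          rw [Finset.sum_add_distrib, ← Finset.sum_mul, Finset.sum_neg_distrib,
            Finset.sum_sub_distrib, hs, Finset.sum_const, nsmul_eq_mul, hcard]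
      _ = ε * log n - ε * log ε := by
          rw [log_div h0.ne' hn.ne', mul_div_cancel₀ _ hn.ne']; ring
  have d1 : negMulLog ε = -(ε * log ε) := by simp [negMulLog]
  have d2 : negMulLog (1 - ε) = -((1 - ε) * log (1 - ε)) := by simp only [negMulLog]; ring
  rw [d1, d2]
  linarith


/-- Entropy-continuity inequality (Equation (11) of Sason 2013): for probability distributions
`p, q` on a finite set with `m ≥ 2` elements, at total variation distance `ε`, the difference of
Shannon entropies (in bits) is at most `ε log₂(m - 1) + h(ε)`, where `h` is the binary entropy
function. -/
theorem entropy_diff_le_of_tv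
    {L : Type*} [Fintype L] (hm : 2 ≤ Fintype.card L)
    (p q : L → ℝ)
    (hp0 : ∀ l, 0 ≤ p l) (hp1 : ∑ l : L, p l = 1)
    (hq0 : ∀ l, 0 ≤ q l) (hq1 : ∑ l : L, q l = 1)
    (ε : ℝ) (hε : ε = (1 / 2) * ∑ l : L, |p l - q l|) :
    |(-∑ l : L, p l * Real.logb 2 (p l)) - (-∑ l : L, q l * Real.logb 2 (q l))| ≤
      ε * Real.logb 2 ((Fintype.card L : ℝ) - 1) +
        (-ε * Real.logb 2 ε - (1 - ε) * Real.logb 2 (1 - ε)) := by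

  have h1 := aux_one_sided hm p q hp0 hp1 hq0 hq1 ε hε
  have h2 := aux_one_sided hm q p hq0 hq1 hp0 hp1 ε (by simp only [abs_sub_comm (q _)]; exact hε)
  have h2pos : 0 < log 2 := log_pos (by norm_num)
  have key : ∀ f : L → ℝ, -∑ l, f l * Real.logb 2 (f l) = (∑ l, negMulLog (f l)) / log 2 := by
    intro f
    rw [Finset.sum_div, ← Finset.sum_neg_distrib]
    refine Finset.sum_congr rfl fun l _ => ?_
    simp only [negMulLog, logb]; ring
  have rhs : ε * Real.logb 2 ((Fintype.card L : ℝ) - 1) +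
        (-ε * Real.logb 2 ε - (1 - ε) * Real.logb 2 (1 - ε)) =
      (ε * log ((Fintype.card L : ℝ) - 1) + (negMulLog ε + negMulLog (1 - ε))) / log 2 := by
    simp only [negMulLog, logb]; ring
  rw [key, key, rhs, ← sub_div, abs_div, abs_of_pos h2pos]
  refine div_le_div_of_nonneg_right (abs_le.2 ⟨?_, ?_⟩) h2pos.le <;> linarith
end
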